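/- (Calabi) Let n ≥ 1, let φ : ℂ^n → ℝ be C^∞ and strongly plurisubharmonic, and let F be a polarization of φ on an open set W ⊆ ℂ^n × ℂ^n containing the diagonal Δ = {(z,z) : z ∈ ℂ^n}. Then there exist an open set V with Δ ⊆ V ⊆ W and a constant C > 0 such that for all (z,q) ∈ V: φ(z) + φ(q) − 2·Re F(z,q) ≥ C·‖z − q‖². (The Calabi diastasis D_φ(z,q) := φ(z) + φ(q) − 2·Re F(z,q) is bounded below by C·‖z − q‖² near the diagonal.) -/

import Mathlib

open scoped ComplexConjugate

noncomputable section

/-- The j-th standard basis vector of ℂⁿ. -/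
def ej {n : ℕ} (j : Fin n) : EuclideanSpace ℂ (Fin n) := EuclideanSpace.single j 1

/-- Second real (Fréchet) derivative of f evaluated on a pair of directions. -/
def D2 {n : ℕ} (f : EuclideanSpace ℂ (Fin n) → ℝ) (z v w : EuclideanSpace ℂ (Fin n)) : ℝ :=
  fderiv ℝ (fderiv ℝ f) z v w

/-- The complex Hessian H_f(z)_{jk} = (∂²f/∂z_j∂z̄_k)(z). -/
def cHess {n : ℕ} (f : EuclideanSpace ℂ (Fin n) → ℝ) (z : EuclideanSpace ℂ (Fin n))
    (j k : Fin n) : ℂ :=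
  (1 / 4 : ℂ) *
    (↑(D2 f z (ej j) (ej k) + D2 f z (Complex.I • ej j) (Complex.I • ej k))
      + Complex.I * ↑(D2 f z (ej j) (Complex.I • ej k) - D2 f z (Complex.I • ej j) (ej k)))

/-- `f` is strongly plurisubharmonic: Σ_{j,k} H_f(z)_{jk}·a_j·conj(a_k) ≥ c·‖a‖² for
some c > 0 and all z, a. -/
def StronglyPsh {n : ℕ} (f : EuclideanSpace ℂ (Fin n) → ℝ) : Prop :=
  ∃ c > (0 : ℝ), ∀ z a : EuclideanSpace ℂ (Fin n),
    c * ‖a‖ ^ 2 ≤ (∑ j, ∑ k, cHess f z j k * a j * conj (a k)).re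

/-- `F` is a polarization of `φ` on `W ⊆ ℂⁿ × ℂⁿ` containing the diagonal. -/
def IsPolarization {n : ℕ} (φ : EuclideanSpace ℂ (Fin n) → ℝ)
    (W : Set (EuclideanSpace ℂ (Fin n) × EuclideanSpace ℂ (Fin n)))
    (F : EuclideanSpace ℂ (Fin n) × EuclideanSpace ℂ (Fin n) → ℂ) : Prop :=
  (∀ w, DifferentiableOn ℂ (fun z => F (z, w)) {z | (z, w) ∈ W}) ∧
  (∀ z, DifferentiableOn ℂ (fun w => conj (F (z, w))) {w | (z, w) ∈ W}) ∧
  (∀ p, F (p, p) = (φ p : ℂ))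

open Metric Set Filter Topology

section PartOne
variable {X : Type*} [NormedAddCommGroup X] [NormedSpace ℂ X]

lemma fderiv_bound {f : X → ℂ} {c : X} {R M : ℝ} (hR : 0 < R)
    (hd : DifferentiableOn ℂ f (ball c R)) (hM : ∀ y ∈ ball c R, ‖f y‖ ≤ M) :
    ‖fderiv ℂ f c‖ ≤ 2 * M / R := by
  refine Complex.norm_fderiv_le_div_of_mapsTo_ball hd ?_ hR
  intro y hy
  rw [mem_closedBall, dist_eq_norm]
  have := hM y hy
  have := hM c (mem_ball_self hR)
  have := norm_sub_le (f y) (f c)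
  linarith

lemma quad_bound {f : X → ℂ} {c : X} {R M : ℝ} (hR : 0 < R)
    (hd : DifferentiableOn ℂ f (ball c R)) (hM : ∀ y ∈ ball c R, ‖f y‖ ≤ M) {y : X}
    (hy : y ∈ ball c R) :
    ‖f y - f c - fderiv ℂ f c (y - c)‖ ≤ 4 * M * (‖y - c‖ / R) ^ 2 := by
  have hf' := fderiv_bound hR hd hM
  have hcd : DifferentiableAt ℂ f c := (hd c (mem_ball_self hR)).differentiableAt (ball_mem_nhds c hR)
  set h : X → ℂ := fun y => f y - fderiv ℂ f c (y - c) with hh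
  have key : ∀ y, h y - h c = f y - f c - fderiv ℂ f c (y - c) := by
    intro y; simp [hh]; ring
  have := Complex.dist_le_mul_div_pow_of_mapsTo_ball_of_isLittleO (f := h) (c := c) (z := y)
    (R₁ := R) (R₂ := 4 * M) (n := 1) ?_ ?_ ?_ hy
  · rw [dist_eq_norm, key, dist_eq_norm] at this
    exact this
  · refine hd.sub ?_
    fun_prop
  · intro z hz
    rw [mem_closedBall, dist_eq_norm, key]
    have h1 := hM z hz
    have h2 := hM c (mem_ball_self hR)
    have h3 := norm_sub_le (f z) (f c)
    have h4 := norm_sub_le (f z - f c) (fderiv ℂ f c (z - c))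
    have h5 := (fderiv ℂ f c).le_opNorm (z - c)
    have h6 : ‖z - c‖ ≤ R := by rw [← dist_eq_norm]; exact (mem_ball.1 hz).le
    have h7 : ‖fderiv ℂ f c‖ * ‖z - c‖ ≤ 2 * M / R * R := by
      have := (norm_nonneg _).trans hf'
      gcongr
    rw [div_mul_cancel₀ _ hR.ne'] at h7
    linarith
  · have := hcd.hasFDerivAt.isLittleO
    simp only [key, pow_one]
    exact this.norm_right

lemma unif_limit {f : ℕ → X → ℂ} {g : X → ℂ} {c : X} {R : ℝ} (hR : 0 < R)
    (hd : ∀ n, DifferentiableOn ℂ (f n) (ball c R))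
    (hu : TendstoUniformlyOn f g atTop (ball c R)) : DifferentiableAt ℂ g c := by
  have hsub : ∀ x ∈ ball c (R/2), ball x (R/2) ⊆ ball c R := by
    intro x hx
    apply ball_subset_ball'
    have := mem_ball.1 hx
    linarith
  have hdat : ∀ n, ∀ x ∈ ball c (R/2), DifferentiableAt ℂ (f n) x := fun n x hx =>
    (hd n).differentiableAt (isOpen_ball.mem_nhds (ball_subset_ball (by linarith) hx))
  have hc : UniformCauchySeqOn (fun n x => fderiv ℂ (f n) x) atTop (ball c (R/2)) := by
    have h1 := hu.uniformCauchySeqOn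
    rw [Metric.uniformCauchySeqOn_iff] at h1 ⊢
    intro ε hε
    obtain ⟨N, hN⟩ := h1 (ε * R / 8) (by positivity)
    refine ⟨N, fun m hm n hn x hx => ?_⟩
    rw [dist_eq_norm, ← fderiv_sub (hdat m x hx) (hdat n x hx)]
    have := fderiv_bound (f := f m - f n) (c := x) (R := R/2) (M := ε * R / 8) (by linarith)
      (((hd m).sub (hd n)).mono (hsub x hx)) ?_
    · refine this.trans_lt ?_
      have : 2 * (ε * R / 8) / (R / 2) = ε / 2 := by field_simp; norm_num
      rw [this]; linarith
    · intro y hy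
      have := hN m hm n hn y (hsub x hx hy)
      rw [dist_eq_norm] at this
      exact this.le
  have hlim : ∀ x ∈ ball c (R/2), ∃ l, Tendsto (fun n => fderiv ℂ (f n) x) atTop (𝓝 l) := by
    intro x hx
    exact cauchySeq_tendsto_of_complete (hc.cauchySeq hx)
  choose! g' hg' using hlim
  have hcs := hc.tendstoUniformlyOn_of_tendsto hg'
  exact (hasFDerivAt_of_tendstoUniformlyOn isOpen_ball hcs
    (fun n x hx => (hdat n x hx).hasFDerivAt)
    (fun x hx => hu.tendsto_at (ball_subset_ball (by linarith) hx))
    (mem_ball_self (by linarith : (0:ℝ) < R/2))).differentiableAt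

lemma fderiv_apply_diff {f : X → ℂ} {U : Set X} (hU : IsOpen U) (hf : DifferentiableOn ℂ f U)
    (v : X) : DifferentiableOn ℂ (fun x => fderiv ℂ f x v) U := by
  intro c hc
  apply DifferentiableAt.differentiableWithinAt
  have hcont : ContinuousAt f c := (hf.differentiableAt (hU.mem_nhds hc)).continuousAt
  have h1 : ∀ᶠ y in 𝓝 c, y ∈ U ∧ ‖f y‖ < ‖f c‖ + 1 :=
    Filter.Eventually.and (hU.mem_nhds hc) (hcont.norm.eventually (gt_mem_nhds (by linarith)))
  obtain ⟨R, hR, hRs⟩ := Metric.eventually_nhds_iff_ball.1 h1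
  set M := ‖f c‖ + 1
  set r : ℝ := R / 4 / (‖v‖ + 1) with hr
  have hvp : 0 < ‖v‖ + 1 := by positivity
  have hrp : 0 < r := by positivity
  set t : ℕ → ℝ := fun n => r / (n + 1) with ht
  have htp : ∀ n, 0 < t n := fun n => by positivity
  have htr : ∀ n, t n ≤ r := fun n => by
    apply div_le_self hrp.le; linarith [(Nat.cast_nonneg n : (0:ℝ) ≤ n)]
  have htv : ∀ n, ‖((t n : ℝ) : ℂ) • v‖ < R / 4 := by
    intro n
    rw [norm_smul, Complex.norm_real, Real.norm_of_nonneg (htp n).le]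
    calc t n * ‖v‖ ≤ r * ‖v‖ := by gcongr; exact htr n
      _ < r * (‖v‖ + 1) := by gcongr; linarith
      _ = R / 4 := by rw [hr]; field_simp
  have hsub : ∀ x ∈ ball c (R/2), ball x (R/2) ⊆ ball c R := by
    intro x hx
    apply ball_subset_ball'
    have := mem_ball.1 hx
    linarith
  have hdR : DifferentiableOn ℂ f (ball c R) := hf.mono fun y hy => (hRs y hy).1
  have hmem : ∀ n, ∀ x, x + ((t n : ℝ) : ℂ) • v ∈ ball x (R/2) := by
    intro n x
    rw [mem_ball, dist_eq_norm, add_sub_cancel_left]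
    linarith [htv n]
  refine unif_limit (f := fun n x => ((t n : ℝ) : ℂ)⁻¹ * (f (x + ((t n : ℝ) : ℂ) • v) - f x))
    (R := R/2) (by linarith) ?_ ?_
  · intro n
    refine DifferentiableOn.const_mul (DifferentiableOn.sub ?_ ?_) _
    · refine hdR.comp (by fun_prop) ?_
      intro x hx
      exact hsub x hx (hmem n x)
    · exact hdR.mono (ball_subset_ball (by linarith))
  · rw [Metric.tendstoUniformlyOn_iff]
    intro ε hε
    have hlim : Tendsto (fun n => t n * (4 * M * (‖v‖ / (R/2))^2)) atTop (𝓝 0) := by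
      have : Tendsto t atTop (𝓝 0) := by
        have := (tendsto_one_div_add_atTop_nhds_zero_nat (𝕜 := ℝ)).const_mul r
        simpa [ht, div_eq_mul_inv] using this
      simpa using this.mul_const _
    filter_upwards [hlim.eventually (gt_mem_nhds hε)] with n hn x hx
    refine lt_of_le_of_lt ?_ hn
    have hq := quad_bound (f := f) (c := x) (R := R/2) (M := M) (by linarith)
      (hdR.mono (hsub x hx)) (fun y hy => (hRs y (hsub x hx hy)).2.le) (hmem n x)
    rw [add_sub_cancel_left, map_smul, norm_smul, Complex.norm_real,
      Real.norm_of_nonneg (htp n).le] at hq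
    have htn : ((t n : ℝ) : ℂ) ≠ 0 := by exact_mod_cast (htp n).ne'
    rw [dist_comm, dist_eq_norm]
    have : ((t n : ℝ) : ℂ)⁻¹ * (f (x + ((t n : ℝ) : ℂ) • v) - f x) - fderiv ℂ f x v
      = ((t n : ℝ) : ℂ)⁻¹ * (f (x + ((t n : ℝ) : ℂ) • v) - f x - ((t n : ℝ) : ℂ) • fderiv ℂ f x v) := by
      rw [smul_eq_mul]; field_simp
    rw [this, norm_mul, norm_inv, Complex.norm_real, Real.norm_of_nonneg (htp n).le,
      inv_mul_le_iff₀ (htp n)]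
    refine hq.trans (le_of_eq ?_)
    ring

lemma holo_contDiffOn [FiniteDimensional ℂ X] {U : Set X} (hU : IsOpen U) (n : ℕ) :
    ∀ {f : X → ℂ}, DifferentiableOn ℂ f U → ContDiffOn ℂ n f U := by
  induction n with
  | zero => intro f hf; simpa using hf.continuousOn
  | succ n ih =>
    intro f hf
    push_cast
    rw [contDiffOn_succ_iff_fderiv_of_isOpen hU]
    refine ⟨hf, by simp, ?_⟩
    rw [contDiffOn_clm_apply]
    intro y
    exact ih (fderiv_apply_diff hU hf y)

lemma holo_fderiv_cont [FiniteDimensional ℂ X] {U : Set X} (hU : IsOpen U) {f : X → ℂ}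
    (hf : DifferentiableOn ℂ f U) : ContinuousOn (fderiv ℂ f) U :=
  (holo_contDiffOn hU 1 hf).continuousOn_fderiv_of_isOpen hU (by simp)

variable {Y : Type*} [NormedAddCommGroup Y] [NormedSpace ℂ Y]

/-- joint continuity of the first partial derivative -/
lemma partial_cont [FiniteDimensional ℂ X] {G : X → Y → ℂ} {p : X} {q : Y} {R M : ℝ}
    (hR : 0 < R)
    (h1 : ∀ w ∈ ball q R, DifferentiableOn ℂ (fun z => G z w) (ball p R))
    (h2 : ∀ z ∈ ball p R, DifferentiableOn ℂ (fun w => G z w) (ball q R))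
    (hM : ∀ z ∈ ball p R, ∀ w ∈ ball q R, ‖G z w‖ ≤ M) :
    ContinuousAt (fun x : X × Y => fderiv ℂ (fun z => G z x.2) x.1) (p, q) := by
  have hM0 : 0 ≤ M := (norm_nonneg _).trans (hM p (mem_ball_self hR) q (mem_ball_self hR))
  have hc : ContinuousAt (fun x : X × Y => fderiv ℂ (fun z => G z q) x.1) (p, q) := by
    have := (holo_fderiv_cont isOpen_ball (h1 q (mem_ball_self hR))).continuousAt (ball_mem_nhds p hR)
    exact ContinuousAt.comp (f := Prod.fst) (x := (p, q)) (by exact this) continuousAt_fst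
  rw [Metric.continuousAt_iff'] at hc ⊢
  intro ε hε
  have hsub : ∀ x ∈ ball p (R/2), ball x (R/2) ⊆ ball p R := by
    intro x hx
    apply ball_subset_ball'
    have := mem_ball.1 hx
    linarith
  have hlim : Tendsto (fun x : X × Y => 2 * ((2 * M) / R * dist x.2 q) / (R/2)) (𝓝 (p, q)) (𝓝 0) := by
    have : Continuous (fun x : X × Y => 2 * ((2 * M) / R * dist x.2 q) / (R/2)) := by fun_prop
    simpa using this.tendsto (p, q)
  have hnb : ball p (R/2) ×ˢ ball q R ∈ 𝓝 (p, q) :=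
    prod_mem_nhds (ball_mem_nhds _ (by linarith)) (ball_mem_nhds _ hR)
  filter_upwards [hc (ε/2) (by linarith), hlim.eventually (gt_mem_nhds (half_pos hε)), hnb]
    with x hx1 hx2 hx3
  obtain ⟨hx31, hx32⟩ := hx3
  refine (dist_triangle _ (fderiv ℂ (fun z => G z q) x.1) _).trans_lt ?_
  have hx31' : x.1 ∈ ball p R := ball_subset_ball (by linarith) hx31
  have d1 := (h1 x.2 hx32).differentiableAt (isOpen_ball.mem_nhds hx31')
  have d2 := (h1 q (mem_ball_self hR)).differentiableAt (isOpen_ball.mem_nhds hx31')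
  have key : dist (fderiv ℂ (fun z => G z x.2) x.1) (fderiv ℂ (fun z => G z q) x.1)
      ≤ 2 * ((2 * M) / R * dist x.2 q) / (R/2) := by
    rw [dist_eq_norm, ← fderiv_sub d1 d2]
    refine fderiv_bound (by linarith)
      (((h1 x.2 hx32).sub (h1 q (mem_ball_self hR))).mono (hsub _ hx31)) ?_
    intro z hz
    have hz' := hsub _ hx31 hz
    have := Complex.dist_le_div_mul_dist_of_mapsTo_ball (f := fun w => G z w) (R₂ := 2 * M) (h2 z hz') ?_ hx32
    · rw [dist_eq_norm] at this; exact this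
    · intro w hw
      rw [mem_closedBall, dist_eq_norm]
      have a1 := hM z hz' w hw
      have a2 := hM z hz' q (mem_ball_self hR)
      have := norm_sub_le (G z w) (G z q)
      linarith
  linarith

lemma osgood [FiniteDimensional ℂ X] [FiniteDimensional ℂ Y] {G : X → Y → ℂ} {U : Set X} {V : Set Y}
    (hU : IsOpen U) (hV : IsOpen V) {M : ℝ}
    (h1 : ∀ w ∈ V, DifferentiableOn ℂ (fun z => G z w) U)
    (h2 : ∀ z ∈ U, DifferentiableOn ℂ (fun w => G z w) V)
    (hM : ∀ z ∈ U, ∀ w ∈ V, ‖G z w‖ ≤ M) :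
    DifferentiableOn ℂ (fun x : X × Y => G x.1 x.2) (U ×ˢ V) := by
  rintro ⟨p, q⟩ ⟨hp, hq⟩
  apply DifferentiableAt.differentiableWithinAt
  obtain ⟨R1, hR1, hs1⟩ := Metric.isOpen_iff.1 hU p hp
  obtain ⟨R2, hR2, hs2⟩ := Metric.isOpen_iff.1 hV q hq
  set R := min R1 R2
  have hR : 0 < R := lt_min hR1 hR2
  have hsU : ball p R ⊆ U := (ball_subset_ball (min_le_left _ _)).trans hs1
  have hsV : ball q R ⊆ V := (ball_subset_ball (min_le_right _ _)).trans hs2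
  have c1 := partial_cont (G := G) (p := p) (q := q) (R := R) (M := M) hR
    (fun w hw => (h1 w (hsV hw)).mono hsU) (fun z hz => (h2 z (hsU hz)).mono hsV)
    (fun z hz w hw => hM z (hsU hz) w (hsV hw))
  have c2 := partial_cont (G := fun w z => G z w) (p := q) (q := p) (R := R) (M := M) hR
    (fun z hz => (h2 z (hsU hz)).mono hsV) (fun w hw => (h1 w (hsV hw)).mono hsU)
    (fun w hw z hz => hM z (hsU hz) w (hsV hw))
  have c2' : ContinuousAt (fun x : X × Y => fderiv ℂ (fun w => G x.1 w) x.2) (p, q) :=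
    ContinuousAt.comp (g := fun x : Y × X => fderiv ℂ (fun w => G x.2 w) x.1) (f := Prod.swap)
      (x := (p, q)) (by exact c2) continuous_swap.continuousAt
  have hnb : U ×ˢ V ∈ 𝓝 (p, q) := prod_mem_nhds (hU.mem_nhds hp) (hV.mem_nhds hq)
  have := hasStrictFDerivAt_uncurry_coprod (𝕜 := ℂ) (u := (p, q)) (f := G)
    (f₁ := fun z w => fderiv ℂ (fun z => G z w) z) (f₂ := fun z w => fderiv ℂ (fun w => G z w) w)
    (by
      filter_upwards [hnb] with v hv
      exact ((h1 v.2 hv.2).differentiableAt (hU.mem_nhds hv.1)).hasFDerivAt)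
    (by
      filter_upwards [hnb] with v hv
      exact ((h2 v.1 hv.1).differentiableAt (hV.mem_nhds hv.2)).hasFDerivAt)
    c1 c2'
  exact this.hasFDerivAt.differentiableAt

end PartOne
section PartTwo
open MeasureTheory

lemma circle_submean {f : ℂ → ℂ} {s p : ℝ} (hs : 1 < s) (hp : 0 < p)
    (hf : DifferentiableOn ℂ f (ball 0 s)) :
    ‖f 0‖ ^ p ≤ Real.circleAverage (fun z => ‖f z‖ ^ p) 0 1 := by
  have hsub : closedBall (0:ℂ) |1| ⊆ ball 0 s := by
    rw [abs_one]; exact closedBall_subset_ball hs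
  have han : AnalyticOnNhd ℂ f (closedBall 0 |1|) :=
    (hf.analyticOnNhd isOpen_ball).mono hsub
  have hci : CircleIntegrable (fun z => ‖f z‖ ^ p) 0 1 := by
    apply ContinuousOn.circleIntegrable (by norm_num)
    have : ContinuousOn f (sphere 0 1) :=
      hf.continuousOn.mono ((sphere_subset_closedBall).trans (by simpa using hsub))
    exact this.norm.rpow_const (fun _ _ => Or.inr hp.le)
  by_cases h0 : f 0 = 0
  · rw [h0, norm_zero, Real.zero_rpow hp.ne']
    apply Real.circleAverage_nonneg_of_nonneg
    intro x hx
    positivity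
  have hn : 0 < ‖f 0‖ := norm_pos_iff.2 h0
  set l : ℝ := Real.exp (1/p) / ‖f 0‖ with hl
  have hlp : 0 < l := by positivity
  set g : ℂ → ℂ := fun z => (l : ℂ) * f z with hg
  have hgn : ∀ z, ‖g z‖ = l * ‖f z‖ := by
    intro z; simp [hg, abs_of_pos hlp]
  have hg0 : ‖g 0‖ = Real.exp (1/p) := by rw [hgn, hl]; field_simp
  have hgan : AnalyticOnNhd ℂ g (closedBall 0 |1|) := fun z hz => analyticAt_const.mul (han z hz)
  have hg0' : g 0 ≠ 0 := by
    rw [← norm_pos_iff, hg0]; positivity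
  have hj : Real.log ‖g 0‖ ≤ Real.circleAverage (fun z => Real.log ‖g z‖) 0 1 := by
    rw [hgan.circleAverage_log_norm one_ne_zero hg0']
    have : 0 ≤ ∑ᶠ u, MeromorphicOn.divisor g (closedBall 0 |1|) u * Real.log (1 * ‖(0:ℂ) - u‖⁻¹) := by
      apply finsum_nonneg
      intro u
      by_cases hu : u ∈ closedBall (0:ℂ) |1|
      · apply mul_nonneg
        · exact_mod_cast MeromorphicOn.AnalyticOnNhd.divisor_nonneg hgan u
        · rw [one_mul, Real.log_inv]
          have : Real.log ‖(0:ℂ) - u‖ ≤ 0 := by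
            apply Real.log_nonpos (norm_nonneg _)
            simpa using hu
          linarith
      · rw [Function.locallyFinsuppWithin.apply_eq_zero_of_notMem _ hu]; simp
    linarith
  have hpt : ∀ z, Real.exp 1 * p * Real.log ‖g z‖ ≤ ‖g z‖ ^ p := by
    intro z
    rcases (norm_nonneg (g z)).eq_or_lt with h | h
    · rw [← h]; simp [Real.zero_rpow hp.ne']
    · rw [Real.rpow_def_of_pos h]
      have := Real.add_one_le_exp (Real.log ‖g z‖ * p - 1)
      have h2 : Real.exp (Real.log ‖g z‖ * p) = Real.exp (Real.log ‖g z‖ * p - 1) * Real.exp 1 := by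
        rw [← Real.exp_add]; ring_nf
      rw [h2]
      nlinarith [Real.exp_pos 1]
  have hlogi : CircleIntegrable (fun z => Real.log ‖g z‖) 0 1 :=
    (hgan.mono sphere_subset_closedBall).meromorphicOn.circleIntegrable_log_norm
  have hgp : (fun z => ‖g z‖ ^ p) = (l ^ p) • (fun z => ‖f z‖ ^ p) := by
    funext z
    simp only [hgn, Pi.smul_apply, smul_eq_mul]
    exact Real.mul_rpow hlp.le (norm_nonneg _)
  have h3 : Real.circleAverage ((Real.exp 1 * p) • fun z => Real.log ‖g z‖) 0 1 ≤
      Real.circleAverage (fun z => ‖g z‖ ^ p) 0 1 := by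
    apply Real.circleAverage_mono
    · exact hlogi.const_smul
    · rw [hgp]; exact hci.const_smul
    · intro z hz
      simpa using hpt z
  rw [Real.circleAverage_smul, hgp, Real.circleAverage_smul, smul_eq_mul, smul_eq_mul] at h3
  have h4 : Real.exp 1 * p * Real.log ‖g 0‖ = l ^ p * ‖f 0‖ ^ p := by
    rw [hg0, Real.log_exp, ← Real.mul_rpow hlp.le hn.le, ← hgn, hg0, ← Real.exp_mul]
    field_simp
  have h5 : Real.exp 1 * p * Real.log ‖g 0‖ ≤
      Real.exp 1 * p * Real.circleAverage (fun z => Real.log ‖g z‖) 0 1 := by gcongr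
  have h6 := (h4.symm.le.trans h5).trans h3
  exact le_of_mul_le_mul_left h6 (by positivity)

lemma circle_submean_lint {f : ℂ → ℂ} {s p : ℝ} (hs : 1 < s) (hp : 0 < p)
    (hf : DifferentiableOn ℂ f (ball 0 s)) :
    ENNReal.ofReal (2 * Real.pi) * ENNReal.ofReal (‖f 0‖ ^ p) ≤
      ∫⁻ θ in Ioc 0 (2 * Real.pi), ENNReal.ofReal (‖f (circleMap 0 1 θ)‖ ^ p) := by
  have h := circle_submean hs hp hf
  have hci : CircleIntegrable (fun z => ‖f z‖ ^ p) 0 1 := by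
    apply ContinuousOn.circleIntegrable (by norm_num)
    have : ContinuousOn f (sphere 0 1) :=
      hf.continuousOn.mono ((sphere_subset_closedBall).trans (closedBall_subset_ball hs))
    exact this.norm.rpow_const (fun _ _ => Or.inr hp.le)
  have hpi : (0:ℝ) < 2 * Real.pi := by positivity
  have hi : IntegrableOn (fun θ => ‖f (circleMap 0 1 θ)‖ ^ p) (Ioc 0 (2 * Real.pi)) :=
    (intervalIntegrable_iff_integrableOn_Ioc_of_le hpi.le).1 hci
  rw [Real.circleAverage_def, smul_eq_mul, intervalIntegral.integral_of_le hpi.le,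
    le_inv_mul_iff₀ hpi] at h
  rw [← ENNReal.ofReal_mul hpi.le, ← ofReal_integral_eq_lintegral_ofReal hi]
  · exact ENNReal.ofReal_le_ofReal h
  · exact ae_of_all _ fun θ => by positivity

variable {X : Type*} [NormedAddCommGroup X] [NormedSpace ℂ X] [FiniteDimensional ℂ X]
  [MeasurableSpace X] [BorelSpace X] (μ : Measure X) [μ.IsAddHaarMeasure]

lemma rot_map (u : Circle) : Measure.map (fun y : X => (u : ℂ) • y) μ = μ := by
  haveI : ProperSpace X := FiniteDimensional.proper ℂ X
  let e : X ≃L[ℂ] X := ContinuousLinearEquiv.smulLeft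
    (Units.mk0 (u : ℂ) (Circle.coe_ne_zero u))
  have he : (e : X → X) = fun y => (u : ℂ) • y := by
    funext y; rfl
  have hH : (Measure.map e μ).IsAddHaarMeasure := e.isAddHaarMeasure_map μ
  rw [← he]
  have h1 := Measure.isAddLeftInvariant_eq_smul (Measure.map e μ) μ
  have h2 := congrArg (fun ν : Measure X => ν (ball 0 1)) h1
  simp only [Measure.smul_apply] at h2
  rw [Measure.map_apply e.continuous.measurable measurableSet_ball] at h2
  have h3 : e ⁻¹' ball 0 1 = ball 0 1 := by
    ext y; simp [he, norm_smul, Circle.norm_coe]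
  rw [h3] at h2
  have hpos : μ (ball (0:X) 1) ≠ 0 := (measure_ball_pos μ 0 one_pos).ne'
  have hfin : μ (ball (0:X) 1) ≠ ⊤ := measure_ball_lt_top.ne
  rw [h1]
  set c := (Measure.map e μ).addHaarScalarFactor μ
  have hc : c = 1 := by
    rw [ENNReal.smul_def, smul_eq_mul] at h2
    have : (c : ENNReal) = 1 := by
      have h4 : (c : ENNReal) * μ (ball (0:X) 1) = 1 * μ (ball (0:X) 1) := by rw [one_mul]; exact h2.symm
      exact (ENNReal.mul_left_inj hpos hfin).1 h4
    exact_mod_cast this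
  rw [hc, one_smul]

lemma ball_submean {f : X → ℂ} {x : X} {r p : ℝ} (hp : 0 < p)
    (hf : DifferentiableOn ℂ f (ball x r)) :
    μ (ball 0 r) * ENNReal.ofReal (‖f x‖ ^ p) ≤ ∫⁻ y in ball x r, ENNReal.ofReal (‖f y‖ ^ p) ∂μ := by
  haveI : ProperSpace X := FiniteDimensional.proper ℂ X
  classical
  set F : X → ENNReal := fun y => ENNReal.ofReal (‖f y‖ ^ p)
  set h : X → ENNReal := (ball 0 r).indicator (fun y => F (x + y)) with hh
  have hcF : ContinuousOn (fun y => F (x + y)) (ball 0 r) := by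
    refine ENNReal.continuous_ofReal.comp_continuousOn ?_
    refine ContinuousOn.rpow_const (ContinuousOn.norm ?_) (fun _ _ => Or.inr hp.le)
    refine hf.continuousOn.comp (by fun_prop) ?_
    intro y hy
    simpa using hy
  have hm : Measurable h := by
    rw [hh, ← Set.piecewise_eq_indicator]
    exact hcF.measurable_piecewise continuousOn_const measurableSet_ball
  have htr : ∫⁻ y in ball x r, F y ∂μ = ∫⁻ y, h y ∂μ := by
    rw [← lintegral_indicator measurableSet_ball,
      ← lintegral_add_left_eq_self (μ := μ) ((ball x r).indicator F) x]
    congr 1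
    funext y
    simp only [hh, Set.indicator]
    congr 1
    simp
  have hrot : ∀ θ : ℝ, ∫⁻ y, h (circleMap 0 1 θ • y) ∂μ = ∫⁻ y, h y ∂μ := by
    intro θ
    have := rot_map μ (Circle.exp θ)
    conv_rhs => rw [← this]
    rw [lintegral_map hm (by fun_prop)]
    simp [circleMap]
  have hpi : (0:ℝ) < 2 * Real.pi := by positivity
  have hE0 : ENNReal.ofReal (2 * Real.pi) ≠ 0 := by simpa using hpi
  rw [htr, ← ENNReal.mul_le_mul_iff_right hE0 ENNReal.ofReal_ne_top]
  have hfub : ENNReal.ofReal (2 * Real.pi) * ∫⁻ y, h y ∂μ =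
      ∫⁻ y, (∫⁻ θ in Ioc 0 (2 * Real.pi), h (circleMap 0 1 θ • y)) ∂μ := by
    rw [← lintegral_lintegral_swap]
    · simp_rw [hrot]
      rw [lintegral_const]
      simp [mul_comm]
    · apply Measurable.aemeasurable
      apply hm.comp
      have : Continuous (fun a : ℝ × X => circleMap 0 1 a.1 • a.2) := by fun_prop
      exact this.measurable
  rw [hfub, mul_comm (μ _), ← mul_assoc]
  calc ENNReal.ofReal (2 * Real.pi) * F x * μ (ball 0 r)
      = ∫⁻ y in ball (0:X) r, ENNReal.ofReal (2 * Real.pi) * F x ∂μ := by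
        rw [setLIntegral_const]
    _ ≤ ∫⁻ y in ball (0:X) r, (∫⁻ θ in Ioc 0 (2 * Real.pi), h (circleMap 0 1 θ • y)) ∂μ := by
        refine setLIntegral_mono' measurableSet_ball ?_
        intro y hy
        have hy' : ‖y‖ < r := by simpa using hy
        have hr : 0 < r := (norm_nonneg y).trans_lt hy'
        have hs : 1 < 2 * r / (r + ‖y‖) := by
          rw [one_lt_div (by positivity)]; linarith
        have := circle_submean_lint (f := fun t => f (x + t • y)) hs hp ?_
        · simp only [zero_smul, add_zero] at this
          refine this.trans (le_of_eq ?_)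
          congr 1
          funext θ
          simp only [hh]
          rw [Set.indicator_of_mem]
          rw [mem_ball_zero_iff, norm_smul, norm_circleMap_zero]
          simpa using hy'
        · refine hf.comp (by fun_prop) ?_
          intro t ht
          rw [mem_ball, dist_eq_norm, add_sub_cancel_left, norm_smul]
          have ht' : ‖t‖ < 2 * r / (r + ‖y‖) := by simpa using ht
          rw [lt_div_iff₀ (by positivity)] at ht'
          nlinarith [norm_nonneg t, norm_nonneg y]
    _ ≤ _ := setLIntegral_le_lintegral _ _

lemma hartogs_lemma {X : Type*} [NormedAddCommGroup X] [NormedSpace ℂ X] [FiniteDimensional ℂ X]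
    [MeasurableSpace X] [BorelSpace X] (μ : Measure X) [μ.IsAddHaarMeasure] {g : ℕ → X → ℂ} {c : X} {ρ L A A' : ℝ} (hρ : 0 < ρ) (hL : 0 ≤ L) (hA : 0 ≤ A)
    (hAA : A < A')
    (hd : ∀ k, DifferentiableOn ℂ (g k) (ball c ρ))
    (hb : ∀ k, 1 ≤ k → ∀ x ∈ ball c ρ, ‖g k x‖ ≤ L ^ k)
    (hpt : ∀ x ∈ ball c ρ, ∀ᶠ k in atTop, ‖g k x‖ ≤ A ^ k) :
    ∃ N, 1 ≤ N ∧ ∀ k ≥ N, ∀ x ∈ ball c (ρ/2), ‖g k x‖ ≤ A' ^ k := by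
  haveI : ProperSpace X := FiniteDimensional.proper ℂ X
  set B : ℕ → Set X := fun N => ⋃ k, ⋃ (_ : N ≤ k), {x ∈ ball c ρ | A ^ k < ‖g k x‖} with hB
  have hBo : ∀ N, IsOpen (B N) := by
    intro N
    refine isOpen_iUnion fun k => isOpen_iUnion fun _ => ?_
    exact (hd k).continuousOn.norm.isOpen_inter_preimage isOpen_ball isOpen_Ioi
  have hBa : Antitone B := by
    intro N N' h
    refine iUnion_mono fun k => ?_
    refine iUnion_subset fun hk => ?_
    exact subset_iUnion_of_subset (h.trans hk) subset_rfl
  have hBs : ∀ N, B N ⊆ ball c ρ := fun N =>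
    iUnion_subset fun k => iUnion_subset fun _ => fun x hx => hx.1
  have hBi : ⋂ N, B N = ∅ := by
    rw [eq_empty_iff_forall_notMem]
    intro x hx
    have hx0 := hBs 0 (mem_iInter.1 hx 0)
    obtain ⟨N, hN⟩ := eventually_atTop.1 (hpt x hx0)
    have := mem_iInter.1 hx N
    simp only [hB, mem_iUnion] at this
    obtain ⟨k, hk, hk2⟩ := this
    exact absurd (hN k hk) (not_le.2 hk2.2)
  have hlim : Tendsto (μ ∘ B) atTop (𝓝 0) := by
    have := tendsto_measure_iInter_atTop (μ := μ) (fun N => (hBo N).measurableSet.nullMeasurableSet)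
      hBa ⟨0, ((measure_mono (hBs 0)).trans_lt measure_ball_lt_top).ne⟩
    rwa [hBi, measure_empty] at this
  set m := μ (ball (0:X) (ρ/2)) with hmdef
  have hm0 : m ≠ 0 := (measure_ball_pos μ 0 (by linarith)).ne'
  have hmt : m ≠ ⊤ := measure_ball_lt_top.ne
  have hlim2 : Tendsto (fun N => ENNReal.ofReal L * μ (B N)) atTop (𝓝 0) := by
    have := ENNReal.Tendsto.const_mul (a := ENNReal.ofReal L) hlim (Or.inr ENNReal.ofReal_ne_top)
    simpa using this
  have hpos : 0 < m * ENNReal.ofReal (A' - A) := by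
    apply ENNReal.mul_pos hm0
    simpa using hAA
  obtain ⟨N, hN1, hN2⟩ := ((eventually_ge_atTop 1).and
    (hlim2.eventually (gt_mem_nhds hpos))).exists
  refine ⟨N, hN1, fun k hk x hx => ?_⟩
  have hk1 : 1 ≤ k := hN1.trans hk
  have hk0 : (k:ℝ) ≠ 0 := by positivity
  have hsub : ball x (ρ/2) ⊆ ball c ρ := by
    apply ball_subset_ball'
    have := mem_ball.1 hx
    linarith
  have h1 := ball_submean μ (f := g k) (x := x) (r := ρ/2) (p := 1 / k) (by positivity)
    ((hd k).mono hsub)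
  have h2 : ∫⁻ y in ball x (ρ/2), ENNReal.ofReal (‖g k y‖ ^ (1 / (k:ℝ))) ∂μ ≤
      ENNReal.ofReal A * m + ENNReal.ofReal L * μ (B N) := by
    calc _ ≤ ∫⁻ y in ball x (ρ/2), (ENNReal.ofReal A + (B N).indicator (fun _ => ENNReal.ofReal L) y) ∂μ := by
          refine setLIntegral_mono' measurableSet_ball ?_
          intro y hy
          by_cases hyB : y ∈ B N
          · rw [Set.indicator_of_mem hyB]
            refine le_add_left (ENNReal.ofReal_le_ofReal ?_)
            calc ‖g k y‖ ^ (1 / (k:ℝ)) ≤ (L ^ k) ^ (1 / (k:ℝ)) := by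
                  gcongr; exact hb k hk1 y (hsub hy)
              _ = L := by rw [one_div]; exact Real.pow_rpow_inv_natCast hL (by omega)
          · rw [Set.indicator_of_notMem hyB, add_zero]
            refine ENNReal.ofReal_le_ofReal ?_
            have : ‖g k y‖ ≤ A ^ k := by
              by_contra hcon
              exact hyB (mem_iUnion.2 ⟨k, mem_iUnion.2 ⟨hk, hsub hy, not_le.1 hcon⟩⟩)
            calc ‖g k y‖ ^ (1 / (k:ℝ)) ≤ (A ^ k) ^ (1 / (k:ℝ)) := by gcongr
              _ = A := by rw [one_div]; exact Real.pow_rpow_inv_natCast hA (by omega)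
      _ = ENNReal.ofReal A * μ (ball x (ρ/2)) +
          ∫⁻ y in ball x (ρ/2), (B N).indicator (fun _ => ENNReal.ofReal L) y ∂μ := by
          rw [lintegral_add_left measurable_const, setLIntegral_const]
      _ ≤ _ := by
          rw [Measure.addHaar_ball_center μ x]
          gcongr
          refine (setLIntegral_le_lintegral _ _).trans ?_
          rw [lintegral_indicator (hBo N).measurableSet, setLIntegral_const]
  have h3 : m * ENNReal.ofReal (‖g k x‖ ^ (1 / (k:ℝ))) ≤ m * ENNReal.ofReal A' := by
    refine (h1.trans h2).trans ?_
    calc ENNReal.ofReal A * m + ENNReal.ofReal L * μ (B N) ≤ ENNReal.ofReal A * m + m * ENNReal.ofReal (A' - A) := by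
          gcongr
      _ = m * ENNReal.ofReal A' := by
          rw [mul_comm _ m, ← mul_add, ← ENNReal.ofReal_add hA (by linarith)]
          congr 2; ring
  rw [ENNReal.mul_le_mul_iff_right hm0 hmt, ENNReal.ofReal_le_ofReal_iff (by linarith)] at h3
  calc ‖g k x‖ = (‖g k x‖ ^ (1 / (k:ℝ))) ^ k := by
        rw [one_div]; exact (Real.rpow_inv_natCast_pow (norm_nonneg _) (by omega)).symm
    _ ≤ A' ^ k := by gcongr
end PartTwo
section PartThree

lemma param_deriv {X : Type*} [NormedAddCommGroup X] [NormedSpace ℂ X] {Ω : Set (X × ℂ)}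
    (hΩ : IsOpen Ω) {H : X × ℂ → ℂ} (hH : DifferentiableOn ℂ H Ω) (k : ℕ) :
    DifferentiableOn ℂ (fun y : X × ℂ => iteratedDeriv k (fun s => H (y.1, s)) y.2) Ω := by
  induction k with
  | zero => simpa using hH
  | succ k ih =>
    refine (fderiv_apply_diff hΩ ih (0, 1)).congr ?_
    intro y hy
    rw [iteratedDeriv_succ]
    have hd := (ih.differentiableAt (hΩ.mem_nhds hy)).hasFDerivAt
    have hc : HasDerivAt (fun s : ℂ => (y.1, s)) ((0 : X), (1 : ℂ)) y.2 :=
      (hasDerivAt_const _ _).prodMk (hasDerivAt_id _)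
    exact (HasFDerivAt.comp_hasDerivAt (x := y.2) (f := fun s : ℂ => (y.1, s)) hd hc).deriv

variable {E1 E2 : Type*} [NormedAddCommGroup E1] [NormedSpace ℂ E1] [FiniteDimensional ℂ E1]
  [NormedAddCommGroup E2] [NormedSpace ℂ E2] [FiniteDimensional ℂ E2]

lemma baire_bdd {G : E1 → E2 → ℂ} {p : E1} {q : E2} {R : ℝ} (hR : 0 < R)
    (h1 : ∀ w ∈ ball q R, DifferentiableOn ℂ (fun z => G z w) (ball p R))
    (h2 : ∀ z ∈ ball p R, DifferentiableOn ℂ (fun w => G z w) (ball q R)) :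
    ∃ w0 ∈ ball q (R/16), ∃ δ > 0, ∃ M : ℝ, ball w0 δ ⊆ ball q R ∧
      ∀ z ∈ ball p (R/2), ∀ w ∈ ball w0 δ, ‖G z w‖ ≤ M := by
  have : ProperSpace E1 := FiniteDimensional.proper ℂ E1
  have : CompleteSpace E2 := FiniteDimensional.complete ℂ E2
  set C : ℕ → Set E2 := fun M => (ball q (R/16))ᶜ ∪
    ⋂ z ∈ closedBall p (R/2), {w ∈ closedBall q (R/16) | ‖G z w‖ ≤ M} with hC
  have hcl : ∀ M, IsClosed (C M) := by
    intro M
    refine isOpen_ball.isClosed_compl.union ?_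
    refine isClosed_biInter fun z hz => ?_
    have hc : ContinuousOn (fun w => ‖G z w‖) (closedBall q (R/16)) :=
      ((h2 z (closedBall_subset_ball (by linarith) hz)).continuousOn.mono
        (closedBall_subset_ball (by linarith))).norm
    exact hc.preimage_isClosed_of_isClosed isClosed_closedBall isClosed_Iic
  have hun : ⋃ M, C M = univ := by
    rw [eq_univ_iff_forall]
    intro w
    rw [mem_iUnion]
    by_cases hw : w ∈ ball q (R/16)
    · have hc : ContinuousOn (fun z => G z w) (closedBall p (R/2)) :=
        (h1 w (ball_subset_ball (by linarith) hw)).continuousOn.mono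
          (closedBall_subset_ball (by linarith))
      obtain ⟨B, hB⟩ := (isCompact_closedBall p (R/2)).exists_bound_of_continuousOn hc
      obtain ⟨M, hM⟩ := exists_nat_ge B
      refine ⟨M, Or.inr ?_⟩
      rw [mem_iInter₂]
      intro z hz
      exact ⟨ball_subset_closedBall hw, (hB z hz).trans hM⟩
    · exact ⟨0, Or.inl hw⟩
  have hd := dense_iUnion_interior_of_closed hcl hun
  obtain ⟨w0, hw0, hw0'⟩ := hd.inter_open_nonempty (ball q (R/16)) isOpen_ball
    ⟨q, mem_ball_self (by linarith)⟩
  rw [mem_iUnion] at hw0'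
  obtain ⟨M, hM⟩ := hw0'
  obtain ⟨δ, hδ, hsub⟩ := Metric.isOpen_iff.1 (isOpen_interior.inter isOpen_ball) w0 ⟨hM, hw0⟩
  refine ⟨w0, hw0, δ, hδ, M, fun w hw => ball_subset_ball (by linarith) (hsub hw).2, ?_⟩
  intro z hz w hw
  have h3 := interior_subset (hsub hw).1
  rcases h3 with h3 | h3
  · exact absurd (hsub hw).2 h3
  · rw [mem_iInter₂] at h3
    exact (h3 z (ball_subset_closedBall hz)).2

theorem hartogs_bdd {G : E1 → E2 → ℂ} {p : E1} {q : E2} {R : ℝ} (hR : 0 < R)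
    (h1 : ∀ w ∈ ball q R, DifferentiableOn ℂ (fun z => G z w) (ball p R))
    (h2 : ∀ z ∈ ball p R, DifferentiableOn ℂ (fun w => G z w) (ball q R)) :
    ∃ M : ℝ, ∀ z ∈ ball p (R/4), ∀ w ∈ ball q (R/8), ‖G z w‖ ≤ M := by
  obtain ⟨w0, hw0, δ, hδ, M, hsub, hM⟩ := baire_bdd hR h1 h2
  have hw0n : ‖w0 - q‖ < R/16 := by simpa [dist_eq_norm] using hw0
  have hjoint := osgood (U := ball p (R/2)) (V := ball w0 δ) isOpen_ball isOpen_ball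
    (fun w hw => (h1 w (hsub hw)).mono (ball_subset_ball (by linarith)))
    (fun z hz => (h2 z (ball_subset_ball (by linarith) hz)).mono hsub) hM
  set H : (E1 × E2) × ℂ → ℂ := fun y => G y.1.1 (w0 + y.2 • y.1.2) with hHdef
  set Φ : (E1 × E2) × ℂ → E1 × E2 := fun y => (y.1.1, w0 + y.2 • y.1.2) with hΦ
  have hΦd : Differentiable ℂ Φ := by rw [hΦ]; fun_prop
  set Ω : Set ((E1 × E2) × ℂ) := Φ ⁻¹' (ball p (R/2) ×ˢ ball w0 δ) with hΩdef
  have hΩ : IsOpen Ω := (isOpen_ball.prod isOpen_ball).preimage hΦd.continuous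
  have hH : DifferentiableOn ℂ H Ω :=
    DifferentiableOn.comp (f := Φ) (g := fun x : E1 × E2 => G x.1 x.2) hjoint hΦd.differentiableOn
      (fun y hy => hy)
  set g : ℕ → E1 × E2 → ℂ := fun k x => ((k.factorial : ℂ))⁻¹ * iteratedDeriv k (fun s => H (x, s)) 0
    with hg
  set c : E1 × E2 := (p, 0) with hc
  have hx1 : ∀ x ∈ ball c (R/2), x.1 ∈ ball p (R/2) := by
    intro x hx
    rw [mem_ball, Prod.dist_eq, max_lt_iff] at hx
    exact hx.1
  have hx2 : ∀ x ∈ ball c (R/2), ‖x.2‖ < R/2 := by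
    intro x hx
    rw [mem_ball, Prod.dist_eq, max_lt_iff] at hx
    simpa [hc] using hx.2
  have hd : ∀ k, DifferentiableOn ℂ (g k) (ball c (R/2)) := by
    intro k
    refine DifferentiableOn.const_mul ?_ _
    refine DifferentiableOn.comp (f := fun x : E1 × E2 => (x, (0:ℂ))) (param_deriv hΩ hH k)
      (by fun_prop) ?_
    intro x hx
    simp only [hΩdef, hΦ, mem_preimage, zero_smul, add_zero]
    exact ⟨hx1 x hx, mem_ball_self hδ⟩
  -- one variable slices
  have hsl : ∀ x ∈ ball c (R/2), DifferentiableOn ℂ (fun s => H (x, s)) (ball 0 (15/8)) := by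
    intro x hx
    refine DifferentiableOn.comp (f := fun s : ℂ => w0 + s • x.2) (g := fun w => G x.1 w)
      (h2 x.1 (ball_subset_ball (by linarith) (hx1 x hx))) (by fun_prop) ?_
    intro s hs
    have hs' : ‖s‖ < 15/8 := by simpa using hs
    rw [mem_ball, dist_eq_norm]
    calc ‖w0 + s • x.2 - q‖ = ‖(w0 - q) + s • x.2‖ := by congr 1; abel
      _ ≤ ‖w0 - q‖ + ‖s‖ * ‖x.2‖ := (norm_add_le _ _).trans (by rw [norm_smul])
      _ < R := by nlinarith [hx2 x hx, norm_nonneg s, norm_nonneg x.2]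
  have hgn : ∀ k x r B, x ∈ ball c (R/2) → 0 < r → r < 15/8 →
      (∀ s ∈ sphere (0:ℂ) r, ‖H (x, s)‖ ≤ B) → ‖g k x‖ ≤ B / r ^ k := by
    intro k x r B hx hr hr' hB
    have h := Complex.norm_iteratedDeriv_le_of_forall_mem_sphere_norm_le k hr
      (((hsl x hx).mono (closedBall_subset_ball hr')).diffContOnCl_ball subset_rfl) hB
    simp only [hg, norm_mul, norm_inv, Complex.norm_natCast]
    rw [inv_mul_le_iff₀ (by positivity)]
    rwa [mul_div_assoc] at h
  set M' := max M 1 with hM'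
  set r0 := min (δ / R) 1 with hr0
  have hr0p : 0 < r0 := by positivity
  set L := M' / r0 with hL
  have hM'1 : 1 ≤ M' := le_max_right _ _
  have hb : ∀ k, 1 ≤ k → ∀ x ∈ ball c (R/2), ‖g k x‖ ≤ L ^ k := by
    intro k hk x hx
    refine (hgn k x r0 M' hx hr0p ((min_le_right _ _).trans_lt (by norm_num)) ?_).trans ?_
    · intro s hs
      refine (hM x.1 (hx1 x hx) _ ?_).trans (le_max_left _ _)
      have hs' : ‖s‖ = r0 := by simpa using hs
      rw [mem_ball, dist_eq_norm, add_sub_cancel_left, norm_smul, hs']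
      have h3 : r0 ≤ δ / R := min_le_left _ _
      rw [le_div_iff₀ hR] at h3
      nlinarith [hx2 x hx, norm_nonneg x.2]
    · rw [hL, div_pow]
      gcongr
      exact le_self_pow₀ hM'1 (by omega)
  have hpt : ∀ x ∈ ball c (R/2), ∀ᶠ k in atTop, ‖g k x‖ ≤ (3/4 : ℝ) ^ k := by
    intro x hx
    obtain ⟨B, hB⟩ := (isCompact_sphere (0:ℂ) (3/2)).exists_bound_of_continuousOn
      ((hsl x hx).continuousOn.mono (sphere_subset_closedBall.trans
        (closedBall_subset_ball (by norm_num))))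
    have hlim : Tendsto (fun k : ℕ => B * (8/9 : ℝ) ^ k) atTop (𝓝 0) := by
      simpa using (tendsto_pow_atTop_nhds_zero_of_lt_one (r := (8/9:ℝ)) (by norm_num)
        (by norm_num)).const_mul B
    filter_upwards [hlim.eventually (gt_mem_nhds one_pos)] with k hk
    refine (hgn k x (3/2) B hx (by norm_num) (by norm_num) hB).trans ?_
    rw [div_le_iff₀ (by positivity)]
    have h4 : (8/9:ℝ) ^ k * ((3/4) ^ k * (3/2) ^ k) = 1 := by
      rw [← mul_pow, ← mul_pow]; norm_num
    have h5 : 0 < ((3/4:ℝ) ^ k * (3/2) ^ k) := by positivity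
    calc B = (B * (8/9) ^ k) * ((3/4) ^ k * (3/2) ^ k) := by rw [mul_assoc, h4, mul_one]
      _ ≤ 1 * ((3/4) ^ k * (3/2) ^ k) := by gcongr
      _ = _ := one_mul _
  have hLp : 0 ≤ L := by positivity
  letI : MeasurableSpace (E1 × E2) := borel _
  haveI : BorelSpace (E1 × E2) := ⟨rfl⟩
  letI : NormedSpace ℝ (E1 × E2) := NormedSpace.restrictScalars ℝ ℂ _
  haveI : FiniteDimensional ℝ (E1 × E2) := FiniteDimensional.complexToReal _
  obtain ⟨N, hN1, hN⟩ := hartogs_lemma (MeasureTheory.Measure.addHaar : MeasureTheory.Measure (E1 × E2))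
    (by positivity) hLp (by norm_num) (show (3/4:ℝ) < 4/5 by norm_num) hd hb hpt
  have hNsum : Summable (fun k : ℕ => (4/5:ℝ) ^ k) := summable_geometric_of_lt_one (by norm_num) (by norm_num)
  -- uniform summable majorant
  set bd : ℕ → ℝ := fun k => (if k < N then M' / r0 ^ k else 0) + (4/5) ^ k with hbd
  have hbds : Summable bd := by
    refine Summable.add ?_ hNsum
    refine summable_of_ne_finset_zero (s := Finset.range N) ?_
    intro k hk
    simp only [Finset.mem_range] at hk
    simp [hk]
  refine ⟨∑' k, bd k, ?_⟩
  intro z hz w hw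
  set x : E1 × E2 := (z, w - w0) with hx
  have hwq : ‖w - q‖ < R/8 := by simpa [dist_eq_norm] using hw
  have hxm : x ∈ ball c (R/2/2) := by
    rw [mem_ball, Prod.dist_eq, max_lt_iff]
    refine ⟨(mem_ball.1 hz).trans_le (by linarith), ?_⟩
    simp only [hx, hc, dist_zero_right]
    calc ‖w - w0‖ = ‖(w - q) - (w0 - q)‖ := by congr 1; abel
      _ ≤ ‖w - q‖ + ‖w0 - q‖ := norm_sub_le _ _
      _ < R/2/2 := by linarith
  have hxm' : x ∈ ball c (R/2) := ball_subset_ball (by linarith) hxm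
  have hs := Complex.hasSum_taylorSeries_on_ball (hsl x hxm') (z := 1) (by simp; norm_num)
  have hgb : ∀ k, ‖g k x‖ ≤ bd k := by
    intro k
    by_cases hk : k < N
    · have : ‖g k x‖ ≤ M' / r0 ^ k := by
        refine (hgn k x r0 M' hxm' hr0p ((min_le_right _ _).trans_lt (by norm_num)) ?_)
        intro s hs
        refine (hM x.1 (hx1 x hxm') _ ?_).trans (le_max_left _ _)
        have hs' : ‖s‖ = r0 := by simpa using hs
        rw [mem_ball, dist_eq_norm, add_sub_cancel_left, norm_smul, hs']
        have h3 : r0 ≤ δ / R := min_le_left _ _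
        rw [le_div_iff₀ hR] at h3
        nlinarith [hx2 x hxm', norm_nonneg x.2]
      simp only [hbd, hk, if_true]
      have : (0:ℝ) < (4/5) ^ k := by positivity
      linarith
    · simp only [hbd, hk, if_false, zero_add]
      exact hN k (not_lt.1 hk) x hxm
  have hval : H (x, 1) = G z w := by simp [hHdef, hx]
  rw [← hval]
  have hs2 : HasSum (fun k => g k x) (H (x, 1)) := by
    refine hs.congr_fun ?_
    intro k
    simp [hg]
  exact hs2.norm_le_of_bounded hbds.hasSum hgb

end PartThree
section PartFour

lemma hartogs_joint {E1 E2 : Type*} [NormedAddCommGroup E1] [NormedSpace ℂ E1]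
    [FiniteDimensional ℂ E1] [NormedAddCommGroup E2] [NormedSpace ℂ E2] [FiniteDimensional ℂ E2]
    {G : E1 → E2 → ℂ} {p : E1} {q : E2} {R : ℝ} (hR : 0 < R)
    (h1 : ∀ w ∈ ball q R, DifferentiableOn ℂ (fun z => G z w) (ball p R))
    (h2 : ∀ z ∈ ball p R, DifferentiableOn ℂ (fun w => G z w) (ball q R)) :
    DifferentiableOn ℂ (fun x : E1 × E2 => G x.1 x.2) (ball (p, q) (R/8)) := by
  obtain ⟨M, hM⟩ := hartogs_bdd hR h1 h2
  rw [← ball_prod_same]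
  refine osgood isOpen_ball isOpen_ball (M := M)
    (fun w hw => (h1 w (ball_subset_ball (by linarith) hw)).mono (ball_subset_ball (by linarith)))
    (fun z hz => (h2 z (ball_subset_ball (by linarith) hz)).mono (ball_subset_ball (by linarith)))
    (fun z hz w hw => hM z (ball_subset_ball (by linarith) hz) w hw)

lemma reflect {ψ : ℂ → ℂ} (hψ : DifferentiableOn ℂ ψ (ball 0 2))
    (hre : ∀ t : ℝ, |t| < 2 → (ψ t).im = 0) : ψ (-Complex.I) = conj (ψ Complex.I) := by
  have hχ : DifferentiableOn ℂ (conj ∘ ψ ∘ conj) (ball 0 2) := by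
    intro z hz
    have hz' : conj z ∈ ball (0:ℂ) 2 := by simpa using hz
    have h1 := (hψ.differentiableAt (isOpen_ball.mem_nhds hz')).conj_conj
    simp only [Complex.conj_conj] at h1
    exact h1.differentiableWithinAt
  have hfr : ∃ᶠ z in 𝓝[≠] (0:ℂ), ψ z = (conj ∘ ψ ∘ conj) z := by
    have ht : Tendsto (fun t : ℝ => (t : ℂ)) (𝓝[≠] 0) (𝓝[≠] 0) := by
      refine tendsto_nhdsWithin_of_tendsto_nhds_of_eventually_within _ ?_ ?_
      · have := (Complex.continuous_ofReal.tendsto 0).mono_left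
          (nhdsWithin_le_nhds (s := {0}ᶜ))
        simpa using this
      · filter_upwards [self_mem_nhdsWithin] with t ht
        simpa using ht
    refine ht.frequently (Eventually.frequently ?_)
    have : ∀ᶠ t : ℝ in 𝓝 0, |t| < 2 := by
      filter_upwards [ball_mem_nhds (0:ℝ) two_pos] with t ht
      simpa using ht
    filter_upwards [nhdsWithin_le_nhds this] with t ht
    simp only [Function.comp, Complex.conj_ofReal]
    exact (Complex.conj_eq_iff_im.2 (hre t ht)).symm
  have heq := (hψ.analyticOnNhd isOpen_ball).eqOn_of_preconnected_of_frequently_eq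
    (hχ.analyticOnNhd isOpen_ball) (convex_ball 0 2).isPreconnected (mem_ball_self two_pos) hfr
  have := heq (x := -Complex.I) (by simp)
  simpa using this

variable {n : ℕ}

/-- coordinatewise conjugation -/
def cj : EuclideanSpace ℂ (Fin n) →ₗᵢ[ℝ] EuclideanSpace ℂ (Fin n) where
  toFun a := WithLp.toLp 2 (fun j => conj (a j))
  map_add' a b := by ext j; simp
  map_smul' c a := by ext j; simp
  norm_map' a := by simp [EuclideanSpace.norm_eq]

lemma cj_apply (a : EuclideanSpace ℂ (Fin n)) (j : Fin n) : cj a j = conj (a j) := rfl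

lemma cj_cj (a : EuclideanSpace ℂ (Fin n)) : cj (cj a) = a := by
  ext j; simp [cj_apply]

lemma cj_smul (c : ℂ) (a : EuclideanSpace ℂ (Fin n)) : cj (c • a) = conj c • cj a := by
  ext j; simp [cj_apply]

lemma cj_ej (j : Fin n) : cj (ej j : EuclideanSpace ℂ (Fin n)) = ej j := by
  ext k
  by_cases h : k = j <;> simp [cj_apply, ej, h]

lemma conj_comp_cj {h : EuclideanSpace ℂ (Fin n) → ℂ} {w : EuclideanSpace ℂ (Fin n)}
    (hh : DifferentiableAt ℂ h (cj w)) : DifferentiableAt ℂ (fun x => conj (h (cj x))) w := by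
  set L := fderiv ℂ h (cj w)
  let L' : EuclideanSpace ℂ (Fin n) →L[ℂ] ℂ :=
    { toFun := fun a => conj (L (cj a))
      map_add' := by intro a b; simp
      map_smul' := by intro c a; simp [cj_smul]
      cont := by
        exact Complex.continuous_conj.comp (L.continuous.comp cj.continuous) }
  have h1 : HasFDerivAt h (L.restrictScalars ℝ) (cj w) := hh.hasFDerivAt.restrictScalars ℝ
  have h2 : HasFDerivAt (fun x => h (cj x)) ((L.restrictScalars ℝ).comp cj.toContinuousLinearMap) w :=
    HasFDerivAt.comp w h1 cj.toContinuousLinearMap.hasFDerivAt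
  have h3 : HasFDerivAt (fun x => conj (h (cj x)))
      ((Complex.conjCLE : ℂ →L[ℝ] ℂ).comp ((L.restrictScalars ℝ).comp cj.toContinuousLinearMap)) w :=
    HasFDerivAt.comp w (Complex.conjCLE : ℂ →L[ℝ] ℂ).hasFDerivAt h2
  exact (hasFDerivAt_of_restrictScalars ℝ (f' := L') h3 (by ext a; rfl)).differentiableAt

lemma bilin_expand (ℓ : EuclideanSpace ℂ (Fin n) →ₗ[ℂ] EuclideanSpace ℂ (Fin n) →ₗ[ℂ] ℂ)
    (a b : EuclideanSpace ℂ (Fin n)) :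
    ℓ a b = ∑ j, ∑ k, ℓ (ej j) (ej k) * a j * b k := by
  have ha : ∀ a : EuclideanSpace ℂ (Fin n), a = ∑ j, a j • ej j := by
    intro a
    ext k
    simp [ej, Pi.single_apply]
  conv_lhs => rw [ha a, ha b]
  simp only [map_sum, LinearMap.sum_apply, map_smul, LinearMap.smul_apply, smul_eq_mul,
    Finset.mul_sum]
  rw [Finset.sum_comm]
  refine Finset.sum_congr rfl fun j _ => Finset.sum_congr rfl fun k _ => ?_
  ring

/-- The embedding onto the (conjugate) diagonal. -/
def io : EuclideanSpace ℂ (Fin n) →L[ℝ] EuclideanSpace ℂ (Fin n) × EuclideanSpace ℂ (Fin n) :=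
  (ContinuousLinearMap.id ℝ _).prod cj.toContinuousLinearMap

lemma io_apply (a : EuclideanSpace ℂ (Fin n)) : io a = (a, cj a) := rfl

lemma hess_alg {φ : EuclideanSpace ℂ (Fin n) → ℝ} {p : EuclideanSpace ℂ (Fin n)}
    (Q : (EuclideanSpace ℂ (Fin n) × EuclideanSpace ℂ (Fin n)) →L[ℂ]
      (EuclideanSpace ℂ (Fin n) × EuclideanSpace ℂ (Fin n)) →L[ℂ] ℂ)
    (hsymm : ∀ v w, Q v w = Q w v)
    (hQ : ∀ v w, D2 φ p v w = (Q (io v) (io w)).re) (a : EuclideanSpace ℂ (Fin n)) :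
    (∑ j, ∑ k, cHess φ p j k * a j * conj (a k)).re = (Q (0, cj a) (a, 0)).re := by
  have hsp : ∀ v w v' w' : EuclideanSpace ℂ (Fin n), Q (v, v') (w, w') =
      Q (v, 0) (w, 0) + Q (v, 0) (0, w') + Q (0, v') (w, 0) + Q (0, v') (0, w') := by
    intro v w v' w'
    have e1 : (v, v') = (v, 0) + ((0 : EuclideanSpace ℂ (Fin n)), v') := by simp
    have e2 : (w, w') = (w, 0) + ((0 : EuclideanSpace ℂ (Fin n)), w') := by simp
    rw [e1, e2]
    simp only [map_add, _root_.add_apply]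
    ring
  have sm1 : ∀ (c : ℂ) (v : EuclideanSpace ℂ (Fin n)),
      (c • v, (0 : EuclideanSpace ℂ (Fin n))) = c • (v, (0 : EuclideanSpace ℂ (Fin n))) := by
    intro c v; simp
  have sm2 : ∀ (c : ℂ) (v : EuclideanSpace ℂ (Fin n)),
      ((0 : EuclideanSpace ℂ (Fin n)), c • v) = c • ((0 : EuclideanSpace ℂ (Fin n)), v) := by
    intro c v; simp
  have hc : ∀ j k, cHess φ p j k =
      (1/2) * (Q (ej j, 0) (0, ej k) + conj (Q (0, ej j) (ej k, 0))) := by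
    intro j k
    simp only [cHess, hQ, io_apply, cj_smul, cj_ej, Complex.conj_I]
    rw [hsp (ej j) (ej k), hsp (Complex.I • ej j) (Complex.I • ej k), hsp (ej j) (Complex.I • ej k),
      hsp (Complex.I • ej j) (ej k)]
    simp only [sm1, sm2, map_smul, _root_.smul_apply, smul_eq_mul]
    apply Complex.ext <;> simp <;> ring
  let ℓ1 : EuclideanSpace ℂ (Fin n) →ₗ[ℂ] EuclideanSpace ℂ (Fin n) →ₗ[ℂ] ℂ :=
    LinearMap.mk₂ ℂ (fun a b => Q (a, 0) (0, b))
      (by intro a a' b; rw [← _root_.add_apply, ← map_add]; simp)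
      (by intro c a b; simp only [sm1, map_smul, _root_.smul_apply])
      (by intro a b b'; rw [← map_add]; simp)
      (by intro c a b; simp only [sm2, map_smul, _root_.smul_apply])
  let ℓ2 : EuclideanSpace ℂ (Fin n) →ₗ[ℂ] EuclideanSpace ℂ (Fin n) →ₗ[ℂ] ℂ :=
    LinearMap.mk₂ ℂ (fun a b => Q (0, a) (b, 0))
      (by intro a a' b; rw [← _root_.add_apply, ← map_add]; simp)
      (by intro c a b; simp only [sm2, map_smul, _root_.smul_apply])
      (by intro a b b'; rw [← map_add]; simp)
      (by intro c a b; simp only [sm1, map_smul, _root_.smul_apply])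
  have h1 := bilin_expand ℓ1 a (cj a)
  have h2 := bilin_expand ℓ2 (cj a) a
  simp only [ℓ1, ℓ2, LinearMap.mk₂_apply, cj_apply] at h1 h2
  have hs : ∑ j, ∑ k, cHess φ p j k * a j * conj (a k) =
      (1/2) * (Q (a, 0) (0, cj a) + conj (Q (0, cj a) (a, 0))) := by
    rw [h1, h2]
    simp only [map_sum, map_mul, Complex.conj_conj, ← Finset.sum_add_distrib, Finset.mul_sum]
    refine Finset.sum_congr rfl fun j _ => Finset.sum_congr rfl fun k _ => ?_
    rw [hc]
    ring
  rw [hs, hsymm (a, 0)]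
  simp
  ring

lemma hess_chain {φ : EuclideanSpace ℂ (Fin n) → ℝ} (hsm : ContDiff ℝ (⊤ : ℕ∞) φ)
    {p : EuclideanSpace ℂ (Fin n)}
    {G : EuclideanSpace ℂ (Fin n) × EuclideanSpace ℂ (Fin n) → ℂ}
    {U : Set (EuclideanSpace ℂ (Fin n) × EuclideanSpace ℂ (Fin n))} (hU : IsOpen U)
    (hp : io p ∈ U) (hG : ContDiffOn ℂ 2 G U) (hφ : ∀ z, io z ∈ U → φ z = (G (io z)).re)
    (v w : EuclideanSpace ℂ (Fin n)) :
    D2 φ p v w = (fderiv ℂ (fderiv ℂ G) (io p) (io v) (io w)).re := by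
  have hUi : ∀ᶠ z in 𝓝 p, io z ∈ U := io.continuous.continuousAt.eventually (hU.mem_nhds hp)
  -- first derivative
  have hd1 : ∀ z, io z ∈ U → fderiv ℝ φ z w = (fderiv ℂ G (io z) (io w)).re := by
    intro z hz
    have hzi : ∀ᶠ y in 𝓝 z, io y ∈ U := io.continuous.continuousAt.eventually (hU.mem_nhds hz)
    have hg : HasFDerivAt G ((fderiv ℂ G (io z)).restrictScalars ℝ) (io z) :=
      (((hG.differentiableOn (by norm_num)).differentiableAt
        (hU.mem_nhds hz)).hasFDerivAt).restrictScalars ℝ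
    have h2 : HasFDerivAt (fun y => (G (io y)).re)
        (Complex.reCLM.comp (((fderiv ℂ G (io z)).restrictScalars ℝ).comp io)) z :=
      HasFDerivAt.comp z Complex.reCLM.hasFDerivAt (HasFDerivAt.comp z hg io.hasFDerivAt)
    have h3 : HasFDerivAt φ
        (Complex.reCLM.comp (((fderiv ℂ G (io z)).restrictScalars ℝ).comp io)) z := by
      refine h2.congr_of_eventuallyEq ?_
      filter_upwards [hzi] with y hy using hφ y hy
    rw [h3.fderiv]; rfl
  have hφ2 : DifferentiableAt ℝ (fderiv ℝ φ) p :=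
    ((contDiff_infty.1 hsm 2).fderiv_right
      (m := 1) (by norm_num)).differentiable (by norm_num) p
  have hA : HasFDerivAt (fun z => fderiv ℝ φ z w) ((fderiv ℝ (fderiv ℝ φ) p).flip w) p := by
    have := hφ2.hasFDerivAt.clm_apply (hasFDerivAt_const w p)
    simpa using this
  have hG2 : DifferentiableAt ℂ (fderiv ℂ G) (io p) :=
    ((hG.fderiv_of_isOpen hU (m := 1) (by norm_num)).differentiableOn (by norm_num)).differentiableAt
      (hU.mem_nhds hp)
  have hB0 : HasFDerivAt (fun x => fderiv ℂ G x (io w))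
      ((fderiv ℂ (fderiv ℂ G) (io p)).flip (io w)) (io p) := by
    have := hG2.hasFDerivAt.clm_apply (hasFDerivAt_const (io w) (io p))
    simpa using this
  have hB : HasFDerivAt (fun z => (fderiv ℂ G (io z) (io w)).re)
      (Complex.reCLM.comp ((((fderiv ℂ (fderiv ℂ G) (io p)).flip (io w)).restrictScalars ℝ).comp io)) p :=
    HasFDerivAt.comp p Complex.reCLM.hasFDerivAt
      (HasFDerivAt.comp p (hB0.restrictScalars ℝ) io.hasFDerivAt)
  have hB' := hB.congr_of_eventuallyEq (f₁ := fun z => fderiv ℝ φ z w)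
    (by filter_upwards [hUi] with z hz using hd1 z hz)
  have := congrArg (fun T => T v) (hA.unique hB')
  exact this

lemma second_diff {E1 E2 : Type*} [NormedAddCommGroup E1] [NormedSpace ℂ E1]
    [NormedAddCommGroup E2] [NormedSpace ℂ E2] {G : E1 × E2 → ℂ} {P : E1} {P' : E2} {η : ℝ}
    (hG : ContDiffOn ℂ 2 G (ball (P, P') η)) {x a : E1} {y b : E2}
    (hx : x ∈ ball P η) (hxa : x + a ∈ ball P η) (hy : y ∈ ball P' η) (hyb : y + b ∈ ball P' η) :
    ∃ ξ ∈ ball (P, P') η, (G (x + a, y + b) - G (x + a, y) - G (x, y + b) + G (x, y)).re =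
      (fderiv ℂ (fderiv ℂ G) ξ (0, b) (a, 0)).re := by
  have hb : ball (P, P') η = ball P η ×ˢ ball P' η := (ball_prod_same _ _ _).symm
  have seg1 : ∀ s ∈ Icc (0:ℝ) 1, x + (s:ℂ) • a ∈ ball P η := by
    intro s hs
    let : NormedSpace ℝ E1 := NormedSpace.restrictScalars ℝ ℂ E1
    have := (convex_ball P η).add_smul_mem hx hxa hs
    exact this
  have seg2 : ∀ s ∈ Icc (0:ℝ) 1, y + (s:ℂ) • b ∈ ball P' η := by
    intro s hs
    let : NormedSpace ℝ E2 := NormedSpace.restrictScalars ℝ ℂ E2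
    have := (convex_ball P' η).add_smul_mem hy hyb hs
    exact this
  have hGd : ∀ ξ ∈ ball (P, P') η, HasFDerivAt G (fderiv ℂ G ξ) ξ := fun ξ hξ =>
    ((hG.differentiableOn (by norm_num)).differentiableAt (isOpen_ball.mem_nhds hξ)).hasFDerivAt
  have hGd2 : ∀ ξ ∈ ball (P, P') η, HasFDerivAt (fderiv ℂ G) (fderiv ℂ (fderiv ℂ G) ξ) ξ :=
    fun ξ hξ => (((hG.fderiv_of_isOpen isOpen_ball (m := 1) (by norm_num)).differentiableOn
      (by norm_num)).differentiableAt (isOpen_ball.mem_nhds hξ)).hasFDerivAt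
  -- first mean value
  have hl1 : ∀ (y' : E2) (s : ℝ), HasDerivAt (fun s : ℝ => (x + (s:ℂ) • a, y')) (a, 0) s := by
    intro y' s
    have h0 : HasDerivAt (fun s : ℝ => (s:ℂ)) 1 s := Complex.ofRealCLM.hasDerivAt
    have h1 := (h0.smul_const a).const_add x
    rw [one_smul] at h1
    exact h1.prodMk (hasDerivAt_const s y')
  have hl2 : ∀ (x' : E1) (s : ℝ), HasDerivAt (fun s : ℝ => (x', y + (s:ℂ) • b)) (0, b) s := by
    intro x' s
    have h0 : HasDerivAt (fun s : ℝ => (s:ℂ)) 1 s := Complex.ofRealCLM.hasDerivAt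
    have h1 := (h0.smul_const b).const_add y
    rw [one_smul] at h1
    exact (hasDerivAt_const s x').prodMk h1
  have hf1 : ∀ y' ∈ ball P' η, ∀ s ∈ Icc (0:ℝ) 1, HasDerivAt (fun s : ℝ => G (x + (s:ℂ) • a, y'))
      (fderiv ℂ G (x + (s:ℂ) • a, y') (a, 0)) s := by
    intro y' hy' s hs
    have hm : (x + (s:ℂ) • a, y') ∈ ball (P, P') η := by rw [hb]; exact ⟨seg1 s hs, hy'⟩
    exact HasFDerivAt.comp_hasDerivAt (f := fun s : ℝ => (x + (s:ℂ) • a, y')) s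
      ((hGd _ hm).restrictScalars ℝ) (hl1 y' s)
  set f : ℝ → ℝ := fun s => (G (x + (s:ℂ) • a, y + b) - G (x + (s:ℂ) • a, y)).re with hf
  have hfd : ∀ s ∈ Icc (0:ℝ) 1, HasDerivAt f
      (fderiv ℂ G (x + (s:ℂ) • a, y + b) (a, 0) - fderiv ℂ G (x + (s:ℂ) • a, y) (a, 0)).re s := by
    intro s hs
    exact Complex.reCLM.hasFDerivAt.comp_hasDerivAt s ((hf1 _ hyb s hs).sub (hf1 _ hy s hs))
  obtain ⟨s, hs, hs'⟩ := exists_hasDerivAt_eq_slope f _ one_pos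
    (fun s hs => (hfd s hs).continuousAt.continuousWithinAt) (fun s hs => hfd s (Ioo_subset_Icc_self hs))
  have hsI := Ioo_subset_Icc_self hs
  set g : ℝ → ℝ := fun t => (fderiv ℂ G (x + (s:ℂ) • a, y + (t:ℂ) • b) (a, 0)).re with hg
  have hgd : ∀ t ∈ Icc (0:ℝ) 1, HasDerivAt g
      (fderiv ℂ (fderiv ℂ G) (x + (s:ℂ) • a, y + (t:ℂ) • b) (0, b) (a, 0)).re t := by
    intro t ht
    have hm : (x + (s:ℂ) • a, y + (t:ℂ) • b) ∈ ball (P, P') η := by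
      rw [hb]; exact ⟨seg1 s hsI, seg2 t ht⟩
    have h1 : HasDerivAt (fun t : ℝ => fderiv ℂ G (x + (s:ℂ) • a, y + (t:ℂ) • b))
        (fderiv ℂ (fderiv ℂ G) (x + (s:ℂ) • a, y + (t:ℂ) • b) (0, b)) t :=
      HasFDerivAt.comp_hasDerivAt (f := fun t : ℝ => (x + (s:ℂ) • a, y + (t:ℂ) • b)) t
        ((hGd2 _ hm).restrictScalars ℝ) (hl2 _ t)
    have h2 := (((ContinuousLinearMap.apply ℂ ℂ ((a, 0) : E1 × E2)).restrictScalars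
      ℝ).hasFDerivAt).comp_hasDerivAt t h1
    exact Complex.reCLM.hasFDerivAt.comp_hasDerivAt t h2
  obtain ⟨t, ht, ht'⟩ := exists_hasDerivAt_eq_slope g _ one_pos
    (fun s hs => (hgd s hs).continuousAt.continuousWithinAt) (fun s hs => hgd s (Ioo_subset_Icc_self hs))
  refine ⟨(x + (s:ℂ) • a, y + (t:ℂ) • b), by rw [hb]; exact ⟨seg1 s hsI, seg2 t (Ioo_subset_Icc_self ht)⟩, ?_⟩
  rw [ht']
  simp only [hf, hg, Complex.ofReal_one, Complex.ofReal_zero, one_smul, zero_smul, add_zero,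
    sub_zero, div_one, Complex.sub_re, Complex.add_re] at hs' ⊢
  linarith

lemma near_norm {A B : Type*} [NormedAddCommGroup A] [NormedAddCommGroup B] {f : A → B} {a : A}
    (hcont : ContinuousAt f a) {ε : ℝ} (hε : 0 < ε) :
    ∃ η > 0, ∀ ξ ∈ ball a η, ‖f ξ - f a‖ < ε := by
  obtain ⟨η, hη, h⟩ := Metric.continuousAt_iff.1 hcont ε hε
  refine ⟨η, hη, fun ξ hξ => ?_⟩
  have := h hξ
  rwa [dist_eq_norm] at this

lemma near_second {E : Type*} [NormedAddCommGroup E] [NormedSpace ℂ E] {G : E → ℂ} {U : Set E}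
    (hU : IsOpen U) (hG : ContDiffOn ℂ 2 G U) {p : E} (hp : p ∈ U) {ε : ℝ} (hε : 0 < ε) :
    ∃ η > 0, ∀ ξ ∈ ball p η, ‖fderiv ℂ (fderiv ℂ G) ξ - fderiv ℂ (fderiv ℂ G) p‖ < ε := by
  have h1 : ContDiffOn ℂ 1 (fderiv ℂ G) U := hG.fderiv_of_isOpen hU (by norm_num)
  have hcont : ContinuousAt (fderiv ℂ (fderiv ℂ G)) p :=
    (h1.continuousOn_fderiv_of_isOpen hU (by norm_num)).continuousAt (hU.mem_nhds hp)
  exact near_norm (B := E →L[ℂ] E →L[ℂ] ℂ) hcont hε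

lemma local_bound {φ : EuclideanSpace ℂ (Fin n) → ℝ} (hsm : ContDiff ℝ (⊤ : ℕ∞) φ)
    {c : ℝ} (hc : 0 < c) (hpsh : ∀ z a : EuclideanSpace ℂ (Fin n),
      c * ‖a‖ ^ 2 ≤ (∑ j, ∑ k, cHess φ z j k * a j * conj (a k)).re)
    {W : Set (EuclideanSpace ℂ (Fin n) × EuclideanSpace ℂ (Fin n))}
    {F : EuclideanSpace ℂ (Fin n) × EuclideanSpace ℂ (Fin n) → ℂ}
    (hW : IsOpen W) (hF : IsPolarization φ W F) (p : EuclideanSpace ℂ (Fin n)) (hp : (p, p) ∈ W) :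
    ∃ η > 0, ∀ z ∈ ball p η, ∀ q ∈ ball p η,
      c / 2 * ‖z - q‖ ^ 2 ≤ φ z + φ q - 2 * (F (z, q)).re := by
  obtain ⟨hF1, hF2, hF3⟩ := hF
  obtain ⟨R, hR, hRW⟩ := Metric.isOpen_iff.1 hW (p, p) hp
  rw [← ball_prod_same] at hRW
  have hcjb : ∀ (r : ℝ) (w : EuclideanSpace ℂ (Fin n)), w ∈ ball (cj p) r → cj w ∈ ball p r := by
    intro r w hw
    rw [mem_ball, dist_eq_norm] at hw ⊢
    rw [← cj.norm_map, map_sub, cj_cj]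
    exact hw
  have hcjb' : ∀ (r : ℝ) (w : EuclideanSpace ℂ (Fin n)), w ∈ ball p r → cj w ∈ ball (cj p) r := by
    intro r w hw
    rw [mem_ball, dist_eq_norm] at hw ⊢
    rw [← map_sub, cj.norm_map]
    exact hw
  have hj := hartogs_joint (G := fun z w => F (z, cj w)) (p := p) (q := cj p) hR
    (by
      intro w hw
      exact (hF1 (cj w)).mono fun z hz => hRW ⟨hz, hcjb R w hw⟩)
    (by
      intro z hz w hw
      have ho : IsOpen {w | (z, w) ∈ W} := hW.preimage (by fun_prop)
      have h1 : DifferentiableAt ℂ (fun w => conj (F (z, w))) (cj w) :=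
        (hF2 z).differentiableAt (ho.mem_nhds (hRW ⟨hz, hcjb R w hw⟩))
      have h2 := conj_comp_cj h1
      simp only [Complex.conj_conj] at h2
      exact h2.differentiableWithinAt)
  set G : EuclideanSpace ℂ (Fin n) × EuclideanSpace ℂ (Fin n) → ℂ := fun x => F (x.1, cj x.2) with hG
  set r := R / 8 with hr
  have hrp : 0 < r := by positivity
  have hGF : ∀ z w, F (z, w) = G (z, cj w) := by
    intro z w; simp [hG, cj_cj]
  have hG2 : ContDiffOn ℂ 2 G (ball (p, cj p) r) := by
    exact_mod_cast holo_contDiffOn isOpen_ball 2 hj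
  have hioφ : ∀ z, φ z = (G (io z)).re := by
    intro z
    rw [io_apply, ← hGF, hF3, Complex.ofReal_re]
  have hpm : io p ∈ ball (p, cj p) r := mem_ball_self hrp
  set Q := fderiv ℂ (fderiv ℂ G) (p, cj p) with hQ
  have hsymm : ∀ v w, Q v w = Q w v := by
    have : ContDiffAt ℂ 2 G (p, cj p) := hG2.contDiffAt (isOpen_ball.mem_nhds hpm)
    intro v w
    exact this.isSymmSndFDerivAt (by simp) v w
  have hlow : ∀ a : EuclideanSpace ℂ (Fin n), c * ‖a‖ ^ 2 ≤ (Q (0, cj a) (a, 0)).re := by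
    intro a
    rw [← hess_alg Q hsymm (fun v w => hess_chain hsm isOpen_ball hpm hG2 (fun z _ => hioφ z) v w) a]
    exact hpsh p a
  -- continuity of the second derivative
  obtain ⟨η0, hη0, hη0'⟩ := near_second isOpen_ball hG2 hpm (show 0 < c / 2 by positivity)
  set η := min η0 (r / 3) with hη
  have hηp : 0 < η := by positivity
  have hηr : η ≤ r / 3 := min_le_right _ _
  have hηη : η ≤ η0 := min_le_left _ _
  refine ⟨η, hηp, ?_⟩
  intro z hz q hq
  -- Hermitian symmetry
  have hherm : (F (q, z)).re = (F (z, q)).re := by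
    set u : EuclideanSpace ℂ (Fin n) := (1/2 : ℂ) • (z + q) with hu
    set v : EuclideanSpace ℂ (Fin n) := (-Complex.I/2 : ℂ) • (z - q) with hv
    have hzn : ‖z - p‖ < η := by simpa [dist_eq_norm] using hz
    have hqn : ‖q - p‖ < η := by simpa [dist_eq_norm] using hq
    have hun : ‖u - p‖ < η := by
      have : u - p = (1/2 : ℂ) • ((z - p) + (q - p)) := by
        rw [hu]; module
      rw [this, norm_smul]
      have h1 := norm_add_le (z - p) (q - p)
      norm_num
      linarith
    have hvn : ‖v‖ < η := by
      have : v = (-Complex.I/2 : ℂ) • ((z - p) - (q - p)) := by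
        rw [hv]; congr 1; abel
      rw [this, norm_smul]
      have h1 := norm_sub_le (z - p) (q - p)
      simp only [norm_div, norm_neg, Complex.norm_I]
      norm_num
      norm_num at h1
      linarith
    have hlm : ∀ l : ℂ, ‖l‖ < 2 → u + l • v ∈ ball p r := by
      intro l hl
      rw [mem_ball, dist_eq_norm]
      calc ‖u + l • v - p‖ = ‖(u - p) + l • v‖ := by congr 1; abel
        _ ≤ ‖u - p‖ + ‖l‖ * ‖v‖ := (norm_add_le _ _).trans (by rw [norm_smul])
        _ < r := by nlinarith [norm_nonneg v, norm_nonneg l]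
    have hcl : ∀ l : ℂ, cj u + l • cj v = cj (u + conj l • v) := by
      intro l
      rw [map_add, cj_smul (conj l) v, Complex.conj_conj]
    have hψ := reflect (ψ := fun l => G (u + l • v, cj u + l • cj v)) ?_ ?_
    · have e1 : u + Complex.I • v = z := by
        rw [hu, hv, smul_smul]
        have : Complex.I * (-Complex.I/2) = 1/2 := by
          rw [mul_div_assoc', mul_neg, Complex.I_mul_I]; norm_num
        rw [this]; module
      have e2 : u + (-Complex.I) • v = q := by
        rw [hu, hv, smul_smul]
        have : (-Complex.I) * (-Complex.I/2) = -1/2 := by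
          rw [mul_div_assoc', neg_mul_neg, Complex.I_mul_I]
        rw [this]; module
      simp only [hcl, map_neg, Complex.conj_I, neg_neg, e1, e2, ← hGF] at hψ
      rw [hψ, Complex.conj_re]
    · refine hj.comp (by fun_prop) ?_
      intro l hl
      have hl' : ‖l‖ < 2 := by simpa using hl
      rw [← ball_prod_same]
      refine ⟨hlm l hl', ?_⟩
      simp only [hcl]
      exact hcjb' r _ (hlm _ (by simpa using hl'))
    · intro t ht
      simp only [hcl, Complex.conj_ofReal, ← hGF, hF3, Complex.ofReal_im]
  -- mean value
  have hsub : ball (p, cj p) η ⊆ ball (p, cj p) r := ball_subset_ball (by linarith)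
  obtain ⟨ξ, hξ, hξ'⟩ := second_diff (hG2.mono hsub) (x := q) (a := z - q) (y := cj q)
    (b := cj (z - q)) hq (by simpa using hz) (hcjb' η q hq)
    (by rw [map_sub, add_sub_cancel]; exact hcjb' η z hz)
  have e3 : q + (z - q) = z := by abel
  have e4 : cj q + cj (z - q) = cj z := by rw [← map_add, e3]
  rw [e3, e4, ← hGF, ← hGF, ← hGF, ← hGF, hF3, hF3] at hξ'
  simp only [Complex.add_re, Complex.sub_re, Complex.ofReal_re, hherm] at hξ'
  set a := z - q with ha
  have hdiff : ‖fderiv ℂ (fderiv ℂ G) ξ - Q‖ < c / 2 := by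
    exact hη0' ξ (ball_subset_ball hηη hξ)
  have hn1 : ‖((0 : EuclideanSpace ℂ (Fin n)), cj a)‖ = ‖a‖ := by
    simp [Prod.norm_def]
  have hn2 : ‖(a, (0 : EuclideanSpace ℂ (Fin n)))‖ = ‖a‖ := by
    simp [Prod.norm_def]
  have herr : ‖(fderiv ℂ (fderiv ℂ G) ξ - Q) (0, cj a) (a, 0)‖ ≤ c / 2 * ‖a‖ ^ 2 := by
    have h1 := (fderiv ℂ (fderiv ℂ G) ξ - Q).le_opNorm₂ (0, cj a) (a, 0)
    rw [hn1, hn2] at h1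
    nlinarith [norm_nonneg a, sq_nonneg ‖a‖]
  have hre := (Complex.abs_re_le_norm _).trans herr
  rw [_root_.sub_apply, _root_.sub_apply, Complex.sub_re] at hre
  have := (abs_le.1 hre).1
  have := hlow a
  linarith

end PartFour
/-- Calabi: for a C^∞ strongly plurisubharmonic φ with polarization F on
an open W containing the diagonal, the Calabi diastasis
D_φ(z,q) = φ(z) + φ(q) − 2·Re F(z,q) satisfies D_φ(z,q) ≥ C‖z − q‖² near the diagonal. -/
theorem calabi_diastasis_lower_bound (n : ℕ) (hn : 1 ≤ n)
    (φ : EuclideanSpace ℂ (Fin n) → ℝ) (hsm : ContDiff ℝ (⊤ : ℕ∞) φ) (hpsh : StronglyPsh φ)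
    (W : Set (EuclideanSpace ℂ (Fin n) × EuclideanSpace ℂ (Fin n)))
    (F : EuclideanSpace ℂ (Fin n) × EuclideanSpace ℂ (Fin n) → ℂ)
    (hW : IsOpen W) (hWdiag : ∀ z : EuclideanSpace ℂ (Fin n), (z, z) ∈ W)
    (hF : IsPolarization φ W F) :
    ∃ (V : Set (EuclideanSpace ℂ (Fin n) × EuclideanSpace ℂ (Fin n))) (C : ℝ),
      IsOpen V ∧ (∀ z : EuclideanSpace ℂ (Fin n), (z, z) ∈ V) ∧ V ⊆ W ∧ 0 < C ∧
      ∀ z q : EuclideanSpace ℂ (Fin n), (z, q) ∈ V →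
        C * ‖z - q‖ ^ 2 ≤ φ z + φ q - 2 * (F (z, q)).re := by
  obtain ⟨c, hc, hpsh⟩ := hpsh
  refine ⟨interior {x | x ∈ W ∧ c / 2 * ‖x.1 - x.2‖ ^ 2 ≤ φ x.1 + φ x.2 - 2 * (F x).re}, c / 2,
    isOpen_interior, ?_, fun x hx => (interior_subset hx).1, by positivity,
    fun z q h => (interior_subset h).2⟩
  intro p
  rw [mem_interior_iff_mem_nhds]
  obtain ⟨η, hη, hb⟩ := local_bound hsm hc hpsh hW hF p (hWdiag p)
  filter_upwards [hW.mem_nhds (hWdiag p), prod_mem_nhds (ball_mem_nhds p hη) (ball_mem_nhds p hη)]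
    with x hx hx2
  exact ⟨hx, hb x.1 hx2.1 x.2 hx2.2⟩
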